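/- arXiv:1312.7755 — 2 statements merged into one kernel-verified Lean document; each statement's English description precedes it below -/
import Mathlib

section
/- Let G ⊂ C_b^∞(ℝ) be a finite-dimensional subspace and let N ⊂ C_b^∞(ℝ) be a subset invariant under multiplication by real numbers such that N ⊂ G and B(N) ⊂ G. Then for any η₁ ∈ F(N,G) and any ν > 0 there exist an integer m ≥ 1 and functions η, ζ̃¹, …, ζ̃^m ∈ G such that ‖η₁ − η + Σ_{j=1}^m B(ζ̃ʲ)‖_{H¹_ul} ≤ ν. -/
open MeasureTheory Real Filter Set
open scoped ENNReal NNReal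

noncomputable section

/-- L² norm on the interval `[a,b]`. -/
def L2I (f : ℝ → ℝ) (a b : ℝ) : ℝ≥0∞ :=
  eLpNorm f 2 (volume.restrict (Set.Icc a b))

/-- Sobolev `H^s` norm on the interval `[a,b]`. -/
def HsI (s : ℕ) (f : ℝ → ℝ) (a b : ℝ) : ℝ≥0∞ :=
  ∑ j ∈ Finset.range (s + 1), L2I (iteratedDeriv j f) a b

/-- Uniformly local Sobolev norm `‖f‖_{H^s_ul}`. -/
def Hul (s : ℕ) (f : ℝ → ℝ) : ℝ≥0∞ := ⨆ x : ℝ, HsI s f x (x + 1)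

/-- Uniformly local `L²` norm. -/
def L2ul (f : ℝ → ℝ) : ℝ≥0∞ := Hul 0 f

/-- `L^∞` norm on `ℝ`. -/
def Linf (f : ℝ → ℝ) : ℝ≥0∞ := eLpNorm f ⊤ volume

/-- `L^∞` norm on `[a,b]`. -/
def LinfI (f : ℝ → ℝ) (a b : ℝ) : ℝ≥0∞ := eLpNorm f ⊤ (volume.restrict (Set.Icc a b))

/-- `W^{k,∞}` norm. -/
def Wkinf (k : ℕ) (f : ℝ → ℝ) : ℝ≥0∞ :=
  ∑ j ∈ Finset.range (k + 1), Linf (iteratedDeriv j f)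

/-- `L^∞` norm on `[0,t] × ℝ`. -/
def Linf2D (u : ℝ → ℝ → ℝ) (t : ℝ) : ℝ≥0∞ :=
  eLpNorm (fun p : ℝ × ℝ => u p.1 p.2) ⊤ ((volume.restrict (Set.Icc 0 t)).prod volume)

/-- `L²` norm on `[0,t] × [y,y+1]`. -/
def L2sq (w : ℝ → ℝ → ℝ) (t y : ℝ) : ℝ≥0∞ :=
  eLpNorm (fun p : ℝ × ℝ => w p.1 p.2) 2
    ((volume.restrict (Set.Icc 0 t)).prod (volume.restrict (Set.Icc y (y + 1))))

/-- The norm `‖w‖_{L²_ul L²([0,t])} = sup_y ‖w‖_{L²([0,t]×[y,y+1])}`. -/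
def L2ulL2 (w : ℝ → ℝ → ℝ) (t : ℝ) : ℝ≥0∞ := ⨆ y : ℝ, L2sq w t y

/-- `L^p`-in-time norm over `[0,T]` of an `ℝ≥0∞`-valued function of `t`. -/
def LpT (p T : ℝ) (F : ℝ → ℝ≥0∞) : ℝ≥0∞ :=
  (∫⁻ t in Set.Icc 0 T, F t ^ p) ^ (1 / p)

/-- Smooth bounded functions: `C_b^∞(ℝ)`. -/
def CbInfty (f : ℝ → ℝ) : Prop :=
  ContDiff ℝ (⊤ : ℕ∞) f ∧ ∀ n : ℕ, ∃ M : ℝ, ∀ x : ℝ, |iteratedDeriv n f x| ≤ M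

/-- The nonlinearity `B(u) = u ∂ₓ u`. -/
def burgB (u : ℝ → ℝ) : ℝ → ℝ := fun x => u x * deriv u x

/-- The span of `cos (λ x)`, `sin (λ x)`, `λ ∈ Λ`. -/
def trigSpan (Λ : Set ℝ) : Submodule ℝ (ℝ → ℝ) :=
  Submodule.span ℝ
    ({f | ∃ l ∈ Λ, f = fun x : ℝ => Real.cos (l * x)} ∪
     {f | ∃ l ∈ Λ, f = fun x : ℝ => Real.sin (l * x)})

/-- The space `F(N,G)`: span of functions `η + ξ ∂ₓ ξ̃ + ξ̃ ∂ₓ ξ`, `η, ξ ∈ G`, `ξ̃ ∈ N`. -/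
def FNG (N : Set (ℝ → ℝ)) (G : Submodule ℝ (ℝ → ℝ)) : Submodule ℝ (ℝ → ℝ) :=
  Submodule.span ℝ
    {f | ∃ η ∈ G, ∃ ξ ∈ G, ∃ ξt ∈ N,
      f = fun x => η x + ξ x * deriv ξt x + ξt x * deriv ξ x}

/-- A smooth control on `[0,T]` with values in the subspace `E ⊂ C_b^∞`. -/
def SmoothControl (E : Submodule ℝ (ℝ → ℝ)) (η : ℝ → ℝ → ℝ) : Prop :=
  (∀ t : ℝ, η t ∈ E) ∧ ∀ x : ℝ, ContDiff ℝ (⊤ : ℕ∞) fun t => η t x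

/-- Classical solution, in the uniformly local class (3.9), of the generalised Burgers
equation `∂ₜu − μ∂ₓ²(u+g) + (u+g)∂ₓ(u+g) = f` on `[0,T] × ℝ` with `u(0,·) = u₀`. -/
structure IsSolGB (μ T : ℝ) (f g : ℝ → ℝ → ℝ) (u₀ : ℝ → ℝ) (u : ℝ → ℝ → ℝ) : Prop where
  init : ∀ x : ℝ, u 0 x = u₀ x
  pde : ∀ t ∈ Set.Ioc 0 T, ∀ x : ℝ,
    deriv (fun s => u s x) t
      - μ * iteratedDeriv 2 (fun z => u t z + g t z) x
      + (u t x + g t x) * deriv (fun z => u t z + g t z) x = f t x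
  bdd : Linf2D u T ≠ ⊤
  bddL2ul : (⨆ t ∈ Set.Icc 0 T, L2ul (u t)) ≠ ⊤
  contL2ul : ∀ t ∈ Set.Ioc 0 T,
    Tendsto (fun s => L2ul fun x => u s x - u t x) (nhdsWithin t (Set.Ioc 0 T)) (nhds 0)
  limit0 : ∀ r : ℝ, 0 < r →
    Tendsto (fun s => L2I (fun x => u s x - u₀ x) (-r) r) (nhdsWithin 0 (Set.Ioi 0)) (nhds 0)
  dx : L2ulL2 (fun t x => deriv (u t) x) T ≠ ⊤

/-- Classical solution, in the same uniformly local class, of the linear equation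
`∂ₜv − μ∂ₓ²v + a ∂ₓv + b v = c` with `v(0,·) = v₀`. -/
structure IsSolLin (μ T : ℝ) (a b c : ℝ → ℝ → ℝ) (v₀ : ℝ → ℝ) (v : ℝ → ℝ → ℝ) : Prop where
  init : ∀ x : ℝ, v 0 x = v₀ x
  pde : ∀ t ∈ Set.Ioc 0 T, ∀ x : ℝ,
    deriv (fun s => v s x) t - μ * iteratedDeriv 2 (v t) x
      + a t x * deriv (v t) x + b t x * v t x = c t x
  bdd : Linf2D v T ≠ ⊤
  bddL2ul : (⨆ t ∈ Set.Icc 0 T, L2ul (v t)) ≠ ⊤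
  contL2ul : ∀ t ∈ Set.Ioc 0 T,
    Tendsto (fun s => L2ul fun x => v s x - v t x) (nhdsWithin t (Set.Ioc 0 T)) (nhds 0)
  limit0 : ∀ r : ℝ, 0 < r →
    Tendsto (fun s => L2I (fun x => v s x - v₀ x) (-r) r) (nhdsWithin 0 (Set.Ioi 0)) (nhds 0)
  dx : L2ulL2 (fun t x => deriv (v t) x) T ≠ ⊤


/-- A differentiable function that is bounded together with its derivative. -/
def BddDeriv (g : ℝ → ℝ) : Prop :=
  Differentiable ℝ g ∧ ∃ M : ℝ, ∀ x : ℝ, |g x| ≤ M ∧ |deriv g x| ≤ M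

theorem BddDeriv.zero : BddDeriv 0 :=
  ⟨differentiable_const (0 : ℝ), 0, fun x => by simp⟩

theorem BddDeriv.add {g h : ℝ → ℝ} (hg : BddDeriv g) (hh : BddDeriv h) : BddDeriv (g + h) := by
  obtain ⟨dg, M, hM⟩ := hg
  obtain ⟨dh, K, hK⟩ := hh
  refine ⟨dg.add dh, M + K, fun x => ⟨?_, ?_⟩⟩
  · exact (abs_add_le _ _).trans (add_le_add (hM x).1 (hK x).1)
  · rw [deriv_add (dg x) (dh x)]
    exact (abs_add_le _ _).trans (add_le_add (hM x).2 (hK x).2)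

theorem CbInfty.differentiable {f : ℝ → ℝ} (hf : CbInfty f) : Differentiable ℝ f :=
  hf.1.differentiable (by simp)

theorem CbInfty.differentiable_deriv {f : ℝ → ℝ} (hf : CbInfty f) :
    Differentiable ℝ (deriv f) := by
  simpa [iteratedDeriv_one] using
    hf.1.differentiable_iteratedDeriv 1 (by exact_mod_cast ENat.natCast_lt_top 1)

theorem CbInfty.bddDeriv_burgB {f : ℝ → ℝ} (hf : CbInfty f) : BddDeriv (burgB f) := by
  have d0 := hf.differentiable
  have d1 := hf.differentiable_deriv
  obtain ⟨A, hA⟩ := hf.2 0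
  obtain ⟨B, hB⟩ := hf.2 1
  obtain ⟨C, hC⟩ := hf.2 2
  simp only [iteratedDeriv_zero, iteratedDeriv_succ] at hA hB hC
  have hA0 : 0 ≤ A := (abs_nonneg _).trans (hA 0)
  have hB0 : 0 ≤ B := (abs_nonneg _).trans (hB 0)
  have hC0 : 0 ≤ C := (abs_nonneg _).trans (hC 0)
  refine ⟨d0.mul d1, A * B + B * B + A * C, fun x => ⟨?_, ?_⟩⟩
  · have : |burgB f x| ≤ A * B := by
      rw [burgB, abs_mul]
      exact mul_le_mul (hA x) (hB x) (abs_nonneg _) hA0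
    nlinarith [mul_nonneg hB0 hB0, mul_nonneg hA0 hC0]
  · have h : deriv (burgB f) x = deriv f x * deriv f x + f x * deriv (deriv f) x :=
      ((d0 x).hasDerivAt.mul (d1 x).hasDerivAt).deriv
    have h1 : |deriv f x * deriv f x| ≤ B * B := by
      rw [abs_mul]
      exact mul_le_mul (hB x) (hB x) (abs_nonneg _) hB0
    have h2 : |f x * deriv (deriv f) x| ≤ A * C := by
      rw [abs_mul]
      exact mul_le_mul (hA x) (hC x) (abs_nonneg _) hA0
    rw [h]
    refine (abs_add_le _ _).trans ?_
    nlinarith [mul_nonneg hA0 hB0]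

theorem L2I_le_of_abs_le {f : ℝ → ℝ} {K : ℝ} (hf : ∀ x, |f x| ≤ K) (a : ℝ) :
    L2I f a (a + 1) ≤ ENNReal.ofReal K := by
  refine (eLpNorm_le_of_ae_bound (C := K) (Eventually.of_forall hf)).trans ?_
  simp

theorem Hul_one_le_of_abs_le {f : ℝ → ℝ} {K : ℝ} (hf : ∀ x, |f x| ≤ K)
    (hf' : ∀ x, |deriv f x| ≤ K) : Hul 1 f ≤ ENNReal.ofReal (2 * K) := by
  have hK : 0 ≤ K := (abs_nonneg _).trans (hf 0)
  refine iSup_le fun x => ?_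
  rw [HsI, Finset.sum_range_succ, Finset.sum_range_one, iteratedDeriv_zero, iteratedDeriv_one,
    two_mul, ENNReal.ofReal_add hK hK]
  exact add_le_add (L2I_le_of_abs_le hf x) (L2I_le_of_abs_le hf' x)

theorem BddDeriv.exists_Hul_smul_le {g : ℝ → ℝ} (hg : BddDeriv g) {ν : ℝ} (hν : 0 < ν) :
    ∃ ε : ℝ, 0 < ε ∧ Hul 1 (fun x => ε ^ 2 * g x) ≤ ENNReal.ofReal ν := by
  obtain ⟨dg, M, hM⟩ := hg
  have hM0 : 0 ≤ M := (abs_nonneg _).trans (hM 0).1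
  have hpos : 0 < ν / (2 * (M + 1)) := by positivity
  refine ⟨√(ν / (2 * (M + 1))), Real.sqrt_pos.2 hpos, ?_⟩
  rw [Real.sq_sqrt hpos.le]
  set t := ν / (2 * (M + 1)) with ht
  refine (Hul_one_le_of_abs_le (K := t * M) (fun x => ?_) fun x => ?_).trans
    (ENNReal.ofReal_le_ofReal ?_)
  · rw [abs_mul, abs_of_pos hpos]
    exact mul_le_mul_of_nonneg_left (hM x).1 hpos.le
  · rw [deriv_const_mul _ (dg x), abs_mul, abs_of_pos hpos]
    exact mul_le_mul_of_nonneg_left (hM x).2 hpos.le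
  · have : t * (2 * (M + 1)) = ν := by rw [ht]; field_simp
    nlinarith

theorem burgB_smul_sub_inv_smul {ξ ξt : ℝ → ℝ} (hξ : Differentiable ℝ ξ)
    (hξt : Differentiable ℝ ξt) {ε : ℝ} (hε : ε ≠ 0) (x : ℝ) :
    burgB (ε • ξ - ε⁻¹ • ξt) x = ε ^ 2 * burgB ξ x + (ε⁻¹) ^ 2 * burgB ξt x
      - (ξ x * deriv ξt x + ξt x * deriv ξ x) := by
  have h : deriv (ε • ξ - ε⁻¹ • ξt) x = ε * deriv ξ x - ε⁻¹ * deriv ξt x :=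
    (((hξ x).hasDerivAt.const_smul ε).sub ((hξt x).hasDerivAt.const_smul ε⁻¹)).deriv
  simp only [burgB, h, Pi.sub_apply, Pi.smul_apply, smul_eq_mul]
  field_simp
  ring

/-- Every element of `FNG N G` agrees, up to an arbitrarily small multiple of a fixed function,
with an element of `G` minus a sum of values of `burgB` on `G`. -/
theorem FNG.exists_eq_sq_mul {G : Submodule ℝ (ℝ → ℝ)} (hGCb : ∀ f ∈ G, CbInfty f)
    {N : Set (ℝ → ℝ)} (hNG : N ⊆ (G : Set (ℝ → ℝ))) (hBN : ∀ f ∈ N, burgB f ∈ G)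
    {η₁ : ℝ → ℝ} (hη₁ : η₁ ∈ FNG N G) :
    ∃ g, BddDeriv g ∧ ∀ ε : ℝ, 0 < ε → ∃ m : ℕ, 1 ≤ m ∧ ∃ η ∈ G, ∃ ζ : Fin m → (ℝ → ℝ),
      (∀ j, ζ j ∈ G) ∧ ∀ x, η₁ x - η x + ∑ j, burgB (ζ j) x = ε ^ 2 * g x := by
  induction hη₁ using Submodule.closure_induction with
  | zero =>
    exact ⟨0, .zero, fun ε _ => ⟨1, le_rfl, 0, G.zero_mem, 0, fun _ => G.zero_mem,
      fun x => by simp [burgB]⟩⟩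
  | add f₁ f₂ _ _ h₁ h₂ =>
    obtain ⟨g₁, hg₁, H₁⟩ := h₁
    obtain ⟨g₂, hg₂, H₂⟩ := h₂
    refine ⟨g₁ + g₂, hg₁.add hg₂, fun ε hε => ?_⟩
    obtain ⟨m₁, hm₁, η₁, hη₁, ζ₁, hζ₁, e₁⟩ := H₁ ε hε
    obtain ⟨m₂, -, η₂, hη₂, ζ₂, hζ₂, e₂⟩ := H₂ ε hε
    refine ⟨m₁ + m₂, by omega, η₁ + η₂, G.add_mem hη₁ hη₂, Fin.append ζ₁ ζ₂, fun j => ?_,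
      fun x => ?_⟩
    · refine Fin.addCases (fun i => ?_) (fun i => ?_) j
      · simpa using hζ₁ i
      · simpa using hζ₂ i
    · simp only [Fin.sum_univ_add, Fin.append_left, Fin.append_right, Pi.add_apply]
      linear_combination e₁ x + e₂ x
  | smul_mem r f hf =>
    obtain ⟨η, hη, ξ, hξ, ξt, hξt, rfl⟩ := hf
    have hξr : r • ξ ∈ G := G.smul_mem r hξ
    have dξ := (hGCb _ hξ).differentiable
    refine ⟨burgB (r • ξ), (hGCb _ hξr).bddDeriv_burgB, fun ε hε => ⟨1, le_rfl,
      r • η + (ε⁻¹) ^ 2 • burgB ξt,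
      G.add_mem (G.smul_mem _ hη) (G.smul_mem _ (hBN _ hξt)),
      fun _ => ε • (r • ξ) - ε⁻¹ • ξt,
      fun _ => G.sub_mem (G.smul_mem _ hξr) (G.smul_mem _ (hNG hξt)), fun x => ?_⟩⟩
    have h : deriv (r • ξ) x = r * deriv ξ x := ((dξ x).hasDerivAt.const_smul r).deriv
    simp only [Finset.univ_unique, Finset.sum_const, Finset.card_singleton, one_smul,
      burgB_smul_sub_inv_smul (hGCb _ hξr).differentiable
        (hGCb _ (hNG hξt)).differentiable hε.ne', h, Pi.add_apply, Pi.smul_apply, smul_eq_mul]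
    ring

/-- (Inequality (4.5)) For any `η₁ ∈ F(N,G)` and `ν > 0` there exist
`m ≥ 1` and `η, ζ̃¹, …, ζ̃ᵐ ∈ G` such that
`‖η₁ − η + Σ_{j=1}^m B(ζ̃ʲ)‖_{H¹_ul} ≤ ν`. -/
theorem statement15
    (G : Submodule ℝ (ℝ → ℝ)) (hGfd : FiniteDimensional ℝ G)
    (hGCb : ∀ f ∈ G, CbInfty f)
    (N : Set (ℝ → ℝ)) (hNCb : ∀ f ∈ N, CbInfty f)
    (hNinv : ∀ c : ℝ, ∀ f ∈ N, (fun x => c * f x) ∈ N)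
    (hNG : N ⊆ (G : Set (ℝ → ℝ)))
    (hBN : ∀ f ∈ N, burgB f ∈ G) :
    ∀ η₁ : ℝ → ℝ, η₁ ∈ FNG N G → ∀ ν : ℝ, 0 < ν →
      ∃ m : ℕ, 1 ≤ m ∧
        ∃ η : ℝ → ℝ, η ∈ G ∧
          ∃ ζ : Fin m → (ℝ → ℝ), (∀ j, ζ j ∈ G) ∧
            Hul 1 (fun x => η₁ x - η x + ∑ j, burgB (ζ j) x) ≤ ENNReal.ofReal ν := by
  intro η₁ hη₁ ν hν
  obtain ⟨g, hg, H⟩ := FNG.exists_eq_sq_mul hGCb hNG hBN hη₁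
  obtain ⟨ε, hε, hle⟩ := hg.exists_Hul_smul_le hν
  obtain ⟨m, hm, η, hη, ζ, hζ, e⟩ := H ε hε
  refine ⟨m, hm, η, hη, ζ, hζ, ?_⟩
  simpa only [e] using hle

end
end

section
/- Let λ₁ > λ₂ > 0 be incommensurable (λ₁/λ₂ irrational). Set Λ = {0, λ₁, λ₂, 2λ₁, 2λ₂, λ₁+λ₂}, N = {c·cos(λ₁x), c·sin(λ₁x), c·cos(λ₂x), c·sin(λ₂x) : c ∈ ℝ}, E₀ = E_Λ, and E_k = F(N, E_{k−1}) for k ≥ 1. For each integer k ≥ 1 define Λ_k = {n₁λ₁ + n₂λ₂ ≥ 0 : n₁, n₂ ∈ ℤ, |n₁| + |n₂| ≤ k}. Then E_{Λ_k} ⊂ E_k for every integer k ≥ 1. -/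
open MeasureTheory Real Filter Set
open scoped ENNReal NNReal

noncomputable section

/-- The set `N = {c cos(λ₁x), c sin(λ₁x), c cos(λ₂x), c sin(λ₂x) : c ∈ ℝ}`. -/
def Nset (l₁ l₂ : ℝ) : Set (ℝ → ℝ) :=
  {f | ∃ c : ℝ, f = fun x : ℝ => c * Real.cos (l₁ * x)} ∪
  {f | ∃ c : ℝ, f = fun x : ℝ => c * Real.sin (l₁ * x)} ∪
  {f | ∃ c : ℝ, f = fun x : ℝ => c * Real.cos (l₂ * x)} ∪
  {f | ∃ c : ℝ, f = fun x : ℝ => c * Real.sin (l₂ * x)}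

/-- The increasing sequence `E₀ = E_Λ`, `E_{k+1} = F(N, E_k)`. -/
def Ek (l₁ l₂ : ℝ) : ℕ → Submodule ℝ (ℝ → ℝ)
  | 0 => trigSpan {0, l₁, l₂, 2 * l₁, 2 * l₂, l₁ + l₂}
  | k + 1 => FNG (Nset l₁ l₂) (Ek l₁ l₂ k)

/-- The frequencies `m` for which both `cos (m x)` and `sin (m x)` belong to `G`. -/
def freqSet (G : Submodule ℝ (ℝ → ℝ)) : Set ℝ :=
  {m | (fun x : ℝ => Real.cos (m * x)) ∈ G ∧ (fun x : ℝ => Real.sin (m * x)) ∈ G}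

lemma le_FNG {N : Set (ℝ → ℝ)} (G : Submodule ℝ (ℝ → ℝ)) (hN : N.Nonempty) : G ≤ FNG N G := by
  intro f hf
  obtain ⟨g, hg⟩ := hN
  refine Submodule.subset_span ⟨f, hf, 0, G.zero_mem, g, hg, ?_⟩
  ext x
  simp

lemma mul_deriv_add_mem_FNG {N : Set (ℝ → ℝ)} {G : Submodule ℝ (ℝ → ℝ)} {u v : ℝ → ℝ}
    (hu : u ∈ G) (hv : v ∈ N) : (fun x => u x * deriv v x + v x * deriv u x) ∈ FNG N G :=
  Submodule.subset_span ⟨0, G.zero_mem, u, hu, v, hv, by ext x; simp⟩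

lemma deriv_cos_const_mul (m x : ℝ) :
    deriv (fun y : ℝ => Real.cos (m * y)) x = -(m * Real.sin (m * x)) := by
  have h := ((hasDerivAt_id x).const_mul m).cos
  simpa [mul_comm] using h.deriv

lemma deriv_sin_const_mul (m x : ℝ) :
    deriv (fun y : ℝ => Real.sin (m * y)) x = m * Real.cos (m * x) := by
  have h := ((hasDerivAt_id x).const_mul m).sin
  simpa [mul_comm] using h.deriv

lemma add_mem_freqSet_FNG {N : Set (ℝ → ℝ)} {G : Submodule ℝ (ℝ → ℝ)} {m l : ℝ}
    (hm : m ∈ freqSet G) (hc : (fun x : ℝ => Real.cos (l * x)) ∈ N)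
    (hs : (fun x : ℝ => Real.sin (l * x)) ∈ N) (hne : m + l ≠ 0) :
    m + l ∈ freqSet (FNG N G) := by
  obtain ⟨hmc, hms⟩ := hm
  constructor
  · convert Submodule.smul_mem _ (m + l)⁻¹ (Submodule.add_mem _
      (mul_deriv_add_mem_FNG hmc hs) (mul_deriv_add_mem_FNG hms hc)) using 1
    ext x
    simp only [Pi.smul_apply, Pi.add_apply, smul_eq_mul, deriv_cos_const_mul,
      deriv_sin_const_mul]
    rw [eq_inv_mul_iff_mul_eq₀ hne, add_mul m l x, Real.cos_add]
    ring
  · convert Submodule.smul_mem _ (m + l)⁻¹ (Submodule.sub_mem _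
      (mul_deriv_add_mem_FNG hms hs) (mul_deriv_add_mem_FNG hmc hc)) using 1
    ext x
    simp only [Pi.smul_apply, Pi.sub_apply, smul_eq_mul, deriv_cos_const_mul,
      deriv_sin_const_mul]
    rw [eq_inv_mul_iff_mul_eq₀ hne, add_mul m l x, Real.sin_add]
    ring

lemma cos_mem_Nset {l₁ l₂ l : ℝ} (hl : l = l₁ ∨ l = -l₁ ∨ l = l₂ ∨ l = -l₂) :
    (fun x : ℝ => Real.cos (l * x)) ∈ Nset l₁ l₂ := by
  rcases hl with rfl | rfl | rfl | rfl
  · exact Or.inl (Or.inl (Or.inl ⟨1, by simp⟩))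
  · exact Or.inl (Or.inl (Or.inl ⟨1, by simp⟩))
  · exact Or.inl (Or.inr ⟨1, by simp⟩)
  · exact Or.inl (Or.inr ⟨1, by simp⟩)

lemma sin_mem_Nset {l₁ l₂ l : ℝ} (hl : l = l₁ ∨ l = -l₁ ∨ l = l₂ ∨ l = -l₂) :
    (fun x : ℝ => Real.sin (l * x)) ∈ Nset l₁ l₂ := by
  rcases hl with rfl | rfl | rfl | rfl
  · exact Or.inl (Or.inl (Or.inr ⟨1, by simp⟩))
  · exact Or.inl (Or.inl (Or.inr ⟨-1, by simp⟩))
  · exact Or.inr ⟨1, by simp⟩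
  · exact Or.inr ⟨-1, by simp⟩

lemma Ek_le_succ (l₁ l₂ : ℝ) (k : ℕ) : Ek l₁ l₂ k ≤ Ek l₁ l₂ (k + 1) :=
  le_FNG _ ⟨_, cos_mem_Nset (Or.inl rfl)⟩

lemma zero_mem_freqSet_Ek (l₁ l₂ : ℝ) (k : ℕ) : (0 : ℝ) ∈ freqSet (Ek l₁ l₂ k) := by
  induction k with
  | zero =>
    exact ⟨Submodule.subset_span (Or.inl ⟨0, by simp, rfl⟩),
      Submodule.subset_span (Or.inr ⟨0, by simp, rfl⟩)⟩
  | succ k ih => exact ⟨Ek_le_succ _ _ k ih.1, Ek_le_succ _ _ k ih.2⟩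

lemma add_mem_freqSet_Ek_succ {l₁ l₂ m l : ℝ} {k : ℕ} (hm : m ∈ freqSet (Ek l₁ l₂ k))
    (hl : l = l₁ ∨ l = -l₁ ∨ l = l₂ ∨ l = -l₂) : m + l ∈ freqSet (Ek l₁ l₂ (k + 1)) := by
  by_cases hne : m + l = 0
  · rw [hne]
    exact zero_mem_freqSet_Ek l₁ l₂ (k + 1)
  · exact add_mem_freqSet_FNG hm (cos_mem_Nset hl) (sin_mem_Nset hl) hne

lemma int_combination_mem_freqSet_Ek (l₁ l₂ : ℝ) (k : ℕ) (n₁ n₂ : ℤ)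
    (hn : |n₁| + |n₂| ≤ (k : ℤ)) : (n₁ * l₁ + n₂ * l₂ : ℝ) ∈ freqSet (Ek l₁ l₂ k) := by
  induction k generalizing n₁ n₂ with
  | zero =>
    obtain ⟨rfl, rfl⟩ : n₁ = 0 ∧ n₂ = 0 := by grind
    simpa using zero_mem_freqSet_Ek l₁ l₂ 0
  | succ k ih =>
    push_cast at hn
    rcases lt_trichotomy n₁ 0 with h | rfl | h
    · convert add_mem_freqSet_Ek_succ (ih (n₁ + 1) n₂ (by grind)) (Or.inr (Or.inl rfl)) using 1
      push_cast
      ring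
    · rcases lt_trichotomy n₂ 0 with h | rfl | h
      · convert add_mem_freqSet_Ek_succ
          (ih 0 (n₂ + 1) (by rw [abs_zero] at hn ⊢; grind)) (Or.inr (Or.inr (Or.inr rfl))) using 1
        push_cast
        ring
      · simpa using zero_mem_freqSet_Ek l₁ l₂ (k + 1)
      · convert add_mem_freqSet_Ek_succ
          (ih 0 (n₂ - 1) (by rw [abs_zero] at hn ⊢; grind)) (Or.inr (Or.inr (Or.inl rfl))) using 1
        push_cast
        ring
    · convert add_mem_freqSet_Ek_succ (ih (n₁ - 1) n₂ (by grind)) (Or.inl rfl) using 1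
      push_cast
      ring

/-- (Lemma 2.7) With
`Λ_k = {n₁λ₁ + n₂λ₂ ≥ 0 : n₁, n₂ ∈ ℤ, |n₁| + |n₂| ≤ k}`, one has `E_{Λ_k} ⊂ E_k`
for every `k ≥ 1`. -/
theorem statement16
    (l₁ l₂ : ℝ) (hl₂ : 0 < l₂) (hl : l₂ < l₁) (hirr : Irrational (l₁ / l₂)) :
    ∀ k : ℕ, 1 ≤ k →
      trigSpan {l : ℝ | 0 ≤ l ∧
          ∃ n₁ n₂ : ℤ, |n₁| + |n₂| ≤ (k : ℤ) ∧ l = n₁ * l₁ + n₂ * l₂} ≤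
        Ek l₁ l₂ k := by
  intro k _
  rw [trigSpan, Submodule.span_le]
  rintro f (⟨l, ⟨-, n₁, n₂, hn, rfl⟩, rfl⟩ | ⟨l, ⟨-, n₁, n₂, hn, rfl⟩, rfl⟩)
  · exact (int_combination_mem_freqSet_Ek l₁ l₂ k n₁ n₂ hn).1
  · exact (int_combination_mem_freqSet_Ek l₁ l₂ k n₁ n₂ hn).2

end
end
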